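/- arXiv:1005.0743 — 5 statements merged into one kernel-verified Lean document; each statement's English description precedes it below -/
import Mathlib

section
/- Let Ψ be a nonzero symmetric valence-4 spinor and κ a nonzero symmetric valence-2 spinor over ℂ² satisfying the integrability condition Ψ_{(ABC}{}^{F} κ_{D)F} = 0 (i.e. the symmetrization over A,B,C,D of Σ_F Σ_G ε^{FG} Ψ_{ABCG} κ_{DF} vanishes for all index values). Then there exists a scalar ψ ∈ ℂ such that Ψ_{ABCD} = ψ κ_{(AB} κ_{CD)} for all index values. -/
open scoped BigOperators

noncomputable section

/-- The antisymmetric ε-spinor: ε₀₁ = 1, ε₁₀ = −1, ε₀₀ = ε₁₁ = 0. -/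
def eps : Fin 2 → Fin 2 → ℂ
  | 0, 1 => 1
  | 1, 0 => -1
  | _, _ => 0

/-- Symmetrization of a valence-4 spinor: the average over all permutations of the indices. -/
def sym4 (T : Fin 2 → Fin 2 → Fin 2 → Fin 2 → ℂ) (A B C D : Fin 2) : ℂ :=
  (1 / 24 : ℂ) * ∑ σ : Equiv.Perm (Fin 4),
    T (![A, B, C, D] (σ 0)) (![A, B, C, D] (σ 1)) (![A, B, C, D] (σ 2)) (![A, B, C, D] (σ 3))

/-- A valence-4 spinor is symmetric if it is invariant under all permutations of its indices. -/
def IsSym4 (T : Fin 2 → Fin 2 → Fin 2 → Fin 2 → ℂ) : Prop :=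
  ∀ (v : Fin 4 → Fin 2) (σ : Equiv.Perm (Fin 4)),
    T (v (σ 0)) (v (σ 1)) (v (σ 2)) (v (σ 3)) = T (v 0) (v 1) (v 2) (v 3)

theorem sum_perm_succ {n : ℕ} (f : Equiv.Perm (Fin (n+1)) → ℂ) :
    ∑ σ, f σ = ∑ p : Fin (n+1), ∑ τ : Equiv.Perm (Fin n), f (Equiv.Perm.decomposeFin.symm (p, τ)) := by
  rw [← Fintype.sum_prod_type', ← Equiv.sum_comp Equiv.Perm.decomposeFin.symm]

theorem sym4_expand (T : Fin 2 → Fin 2 → Fin 2 → Fin 2 → ℂ) (A B C D : Fin 2) :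
    sym4 T A B C D = (1 / 24 : ℂ) * (
      T A B C D + T A B D C + T A C B D + T A C D B + T A D B C + T A D C B
    + T B A C D + T B A D C + T B C A D + T B C D A + T B D A C + T B D C A
    + T C A B D + T C A D B + T C B A D + T C B D A + T C D A B + T C D B A
    + T D A B C + T D A C B + T D B A C + T D B C A + T D C A B + T D C B A) := by
  unfold sym4
  congr 1
  have e1 : (1 : Fin 4) = Fin.succ 0 := rfl
  have e2 : (2 : Fin 4) = Fin.succ (Fin.succ 0) := rfl
  have e3 : (3 : Fin 4) = Fin.succ (Fin.succ (Fin.succ 0)) := rfl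
  simp only [sum_perm_succ, Fin.sum_univ_succ, Finset.univ_unique, Finset.sum_singleton,
    e1, e2, e3, Equiv.Perm.decomposeFin_symm_apply_zero, Equiv.Perm.decomposeFin_symm_apply_succ]
  simp [Equiv.swap_apply_def, Fin.ext_iff]
  ring

/-- If a nonzero symmetric valence-4 spinor Ψ and a nonzero symmetric valence-2 spinor κ
satisfy the integrability condition Ψ_{(ABC}{}^F κ_{D)F} = 0, then Ψ_{ABCD} = ψ κ_{(AB}κ_{CD)}
for some scalar ψ. -/
theorem integrability_forces_proportionality
    (Ψ : Fin 2 → Fin 2 → Fin 2 → Fin 2 → ℂ) (κ : Fin 2 → Fin 2 → ℂ)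
    (hΨsym : IsSym4 Ψ) (hκsym : ∀ A B, κ A B = κ B A)
    (hΨne : ∃ A B C D, Ψ A B C D ≠ 0) (hκne : ∃ A B, κ A B ≠ 0)
    (hint : ∀ A B C D,
      sym4 (fun A B C D => ∑ F, ∑ G, eps F G * Ψ A B C G * κ D F) A B C D = 0) :
    ∃ ψ : ℂ, ∀ A B C D,
      Ψ A B C D = ψ * sym4 (fun A B C D => κ A B * κ C D) A B C D := by
  have p (v : Fin 4 → Fin 2) (i j : Fin 4) := hΨsym v (Equiv.swap i j)
  have s1 : ∀ A B C D, Ψ A B C D = Ψ B A C D := fun A B C D => by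
    simpa [Equiv.swap_apply_def] using p ![B, A, C, D] 0 1
  have s2 : ∀ A B C D, Ψ A B C D = Ψ A C B D := fun A B C D => by
    simpa [Equiv.swap_apply_def] using p ![A, C, B, D] 1 2
  have s3 : ∀ A B C D, Ψ A B C D = Ψ A B D C := fun A B C D => by
    simpa [Equiv.swap_apply_def] using p ![A, B, D, C] 2 3
  have k10 : κ 1 0 = κ 0 1 := hκsym 1 0
  have q1 : Ψ 0 0 1 0 = Ψ 0 0 0 1 := s3 _ _ _ _
  have q2 : Ψ 0 1 0 0 = Ψ 0 0 0 1 := (s2 _ _ _ _).trans q1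
  have q3 : Ψ 1 0 0 0 = Ψ 0 0 0 1 := (s1 _ _ _ _).trans q2
  have r1 : Ψ 0 1 0 1 = Ψ 0 0 1 1 := s2 _ _ _ _
  have r2 : Ψ 1 0 0 1 = Ψ 0 0 1 1 := (s1 _ _ _ _).trans r1
  have r3 : Ψ 0 1 1 0 = Ψ 0 0 1 1 := (s3 _ _ _ _).trans r1
  have r4 : Ψ 1 0 1 0 = Ψ 0 0 1 1 := (s3 _ _ _ _).trans r2
  have r5 : Ψ 1 1 0 0 = Ψ 0 0 1 1 := (s2 _ _ _ _).trans r4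
  have t1 : Ψ 1 0 1 1 = Ψ 0 1 1 1 := s1 _ _ _ _
  have t2 : Ψ 1 1 0 1 = Ψ 0 1 1 1 := (s2 _ _ _ _).trans t1
  have t3 : Ψ 1 1 1 0 = Ψ 0 1 1 1 := (s3 _ _ _ _).trans t2
  have h0 := hint 0 0 0 0
  have h1 := hint 0 0 0 1
  have h2 := hint 0 0 1 1
  have h3 := hint 0 1 1 1
  have h4 := hint 1 1 1 1
  simp only [sym4_expand, Fin.sum_univ_two, eps, k10, q1, q2, q3, r1, r2, r3, r4, r5, t1, t2, t3]
    at h0 h1 h2 h3 h4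
  have key : ∃ ψ : ℂ, Ψ 0 0 0 0 = ψ * κ 0 0 ^ 2 ∧ Ψ 0 0 0 1 = ψ * (κ 0 0 * κ 0 1) ∧
      Ψ 0 0 1 1 = ψ * ((κ 0 0 * κ 1 1 + 2 * κ 0 1 ^ 2) / 3) ∧
      Ψ 0 1 1 1 = ψ * (κ 0 1 * κ 1 1) ∧ Ψ 1 1 1 1 = ψ * κ 1 1 ^ 2 := by
    generalize Ψ 0 0 0 0 = a0 at *
    generalize Ψ 0 0 0 1 = a1 at *
    generalize Ψ 0 0 1 1 = a2 at *
    generalize Ψ 0 1 1 1 = a3 at *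
    generalize Ψ 1 1 1 1 = a4 at *
    have hk : κ 0 0 ≠ 0 ∨ κ 1 1 ≠ 0 ∨ (κ 0 0 = 0 ∧ κ 1 1 = 0 ∧ κ 0 1 ≠ 0) := by
      by_contra! hc
      obtain ⟨c1, c2, c3⟩ := hc
      obtain ⟨A, B, hAB⟩ := hκne
      have c4 := c3 c1 c2
      apply hAB
      fin_cases A <;> fin_cases B <;> simp [*]
    generalize κ 0 0 = x at *
    generalize κ 0 1 = y at *
    generalize κ 1 1 = z at *
    have g0 : a1 * x = a0 * y := by linear_combination h0
    have g1 : 3 * a2 * x = 2 * a1 * y + a0 * z := by linear_combination 4 * h1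
    have g2 : a3 * x = a1 * z := by linear_combination 2 * h2
    have g3 : a4 * x + 2 * a3 * y = 3 * a2 * z := by linear_combination 4 * h3
    have g4 : a4 * y = a3 * z := by linear_combination h4
    clear h0 h1 h2 h3 h4
    rcases hk with hx | hz | ⟨hx, hz, hy⟩
    · have e1 : a1 = a0 * y / x := by field_simp; linear_combination g0
      have e2 : a2 = (2 * a1 * y + a0 * z) / (3 * x) := by field_simp; linear_combination g1
      have e3 : a3 = a1 * z / x := by field_simp; linear_combination g2
      have e4 : a4 = (3 * a2 * z - 2 * a3 * y) / x := by field_simp; linear_combination g3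
      refine ⟨a0 / x ^ 2, ?_, ?_, ?_, ?_, ?_⟩ <;> (try rw [e4]) <;> (try rw [e3]) <;>
        (try rw [e2]) <;> (try rw [e1]) <;> field_simp <;> ring
    · have e3 : a3 = a4 * y / z := by field_simp; linear_combination -g4
      have e2 : a2 = (2 * a3 * y + a4 * x) / (3 * z) := by field_simp; linear_combination -g3
      have e1 : a1 = a3 * x / z := by field_simp; linear_combination -g2
      have e0 : a0 = (3 * a2 * x - 2 * a1 * y) / z := by field_simp; linear_combination -g1
      refine ⟨a4 / z ^ 2, ?_, ?_, ?_, ?_, ?_⟩ <;> (try rw [e0]) <;> (try rw [e1]) <;>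
        (try rw [e2]) <;> (try rw [e3]) <;> field_simp <;> ring
    · subst hx hz
      have e0 : a0 = 0 := by simpa [hy] using g0
      have e1 : a1 = 0 := by simpa [hy] using g1
      have e3 : a3 = 0 := by simpa [hy] using g3
      have e4 : a4 = 0 := by simpa [hy] using g4
      refine ⟨3 * a2 / (2 * y ^ 2), ?_, ?_, ?_, ?_, ?_⟩ <;> simp [e0, e1, e3, e4]
      field_simp
  obtain ⟨ψ, w0, w1, w2, w3, w4⟩ := key
  refine ⟨ψ, fun A B C D => ?_⟩
  rw [sym4_expand]
  fin_cases A <;> fin_cases B <;> fin_cases C <;> fin_cases D <;>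
    simp only [Fin.zero_eta, Fin.mk_one, Fin.isValue, k10, q1, q2, q3, r1, r2, r3, r4, r5,
      t1, t2, t3, w0, w1, w2, w3, w4] <;> ring

end
end

section
/- Let κ be a nonzero symmetric valence-2 spinor over ℂ², let ψ ∈ ℂ be nonzero, and set Ψ_{ABCD} = ψ κ_{(AB} κ_{CD)}. Then Ψ has a fourfold repeated principal spinor (i.e. there exist c ∈ ℂ and α ∈ ℂ² with Ψ_{ABCD} = c α_A α_B α_C α_D for all index values) if and only if κ is algebraically special (i.e. there exists α ∈ ℂ² with κ_{AB} = α_A α_B for all index values). -/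
open scoped BigOperators

noncomputable section

theorem sym4_formula (κ : Fin 2 → Fin 2 → ℂ) (h : ∀ A B, κ A B = κ B A) (A B C D : Fin 2) :
    sym4 (fun A B C D => κ A B * κ C D) A B C D
      = (κ A B * κ C D + κ A C * κ B D + κ A D * κ B C) / 3 := by
  unfold sym4
  rw [← Equiv.sum_comp (Equiv.Perm.decomposeFin (n := 3)).symm, Fintype.sum_prod_type]
  simp_rw [← Equiv.sum_comp (Equiv.Perm.decomposeFin (n := 2)).symm, Fintype.sum_prod_type,
    ← Equiv.sum_comp (Equiv.Perm.decomposeFin (n := 1)).symm, Fintype.sum_prod_type]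
  have e1 : (1 : Fin 4) = Fin.succ 0 := rfl
  have e2 : (2 : Fin 4) = Fin.succ (Fin.succ 0) := rfl
  have e3 : (3 : Fin 4) = Fin.succ (Fin.succ (Fin.succ 0)) := rfl
  have f1 : (1 : Fin 3) = Fin.succ 0 := rfl
  have f2 : (2 : Fin 3) = Fin.succ (Fin.succ 0) := rfl
  simp only [Fin.sum_univ_succ, Finset.univ_unique, Finset.sum_singleton, e1, e2, e3,
    Equiv.Perm.decomposeFin_symm_apply_zero, Equiv.Perm.decomposeFin_symm_apply_succ]
  simp [Equiv.swap_apply_def, Fin.ext_iff]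
  rw [h B A, h C A, h D A, h C B, h D B, h D C]
  ring

/-- For Ψ_{ABCD} = ψ κ_{(AB}κ_{CD)} with κ nonzero symmetric and ψ ≠ 0,
Ψ has a fourfold repeated principal spinor if and only if κ is algebraically special. -/
theorem typeN_iff_kappa_special
    (κ : Fin 2 → Fin 2 → ℂ) (ψ : ℂ)
    (hκsym : ∀ A B, κ A B = κ B A) (hκne : ∃ A B, κ A B ≠ 0) (hψ : ψ ≠ 0)
    (Ψ : Fin 2 → Fin 2 → Fin 2 → Fin 2 → ℂ)
    (hΨ : ∀ A B C D, Ψ A B C D = ψ * sym4 (fun A B C D => κ A B * κ C D) A B C D) :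
    (∃ (c : ℂ) (α : Fin 2 → ℂ), ∀ A B C D, Ψ A B C D = c * α A * α B * α C * α D)
      ↔ (∃ α : Fin 2 → ℂ, ∀ A B, κ A B = α A * α B) := by
  have F : ∀ A B C D, Ψ A B C D = ψ * ((κ A B * κ C D + κ A C * κ B D + κ A D * κ B C) / 3) :=
    fun A B C D => by rw [hΨ, sym4_formula κ hκsym]
  constructor
  · rintro ⟨c, α, hα⟩
    have g : ∀ A B C D, (κ A B * κ C D + κ A C * κ B D + κ A D * κ B C) / 3
        = (c / ψ) * α A * α B * α C * α D := fun A B C D => by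
      have := hα A B C D
      rw [F] at this
      field_simp at this ⊢
      linear_combination this
    generalize c / ψ = k at g
    have h0 := g 0 0 0 0
    have h1 := g 0 0 0 1
    have h2 := g 0 0 1 1
    have h3 := g 0 1 1 1
    have h4 := g 1 1 1 1
    have s := hκsym 1 0
    rw [s] at *
    generalize ha : κ 0 0 = a at *
    generalize hb : κ 0 1 = b at *
    generalize hd : κ 1 1 = d at *
    generalize α 0 = x at *
    generalize α 1 = y at *
    have h0' : a ^ 2 = k * x ^ 4 := by linear_combination h0
    have h1' : a * b = k * x ^ 3 * y := by linear_combination h1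
    have h2' : (a * d + 2 * b ^ 2) / 3 = k * x ^ 2 * y ^ 2 := by linear_combination h2
    have h3' : b * d = k * x * y ^ 3 := by linear_combination h3
    have h4' : d ^ 2 = k * y ^ 4 := by linear_combination h4
    have key : b ^ 2 = a * d := by
      have ea : a ^ 2 * (a * d - b ^ 2) = 0 := by
        linear_combination 3 * a ^ 2 * h2' + 3 * k * x ^ 2 * y ^ 2 * h0'
          - 3 * (a * b + k * x ^ 3 * y) * h1'
      have ed : d ^ 2 * (a * d - b ^ 2) = 0 := by
        linear_combination 3 * d ^ 2 * h2' + 3 * k * x ^ 2 * y ^ 2 * h4'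
          - 3 * (b * d + k * x * y ^ 3) * h3'
      rcases mul_eq_zero.1 ea with e | e
      · rcases mul_eq_zero.1 ed with e' | e'
        · have a0 : a = 0 := by simpa using e
          have d0 : d = 0 := by simpa using e'
          have : k * x ^ 4 = 0 := by rw [← h0', e]
          have z : k * x ^ 2 * y ^ 2 = 0 := by
            rcases mul_eq_zero.1 this with q | q
            · simp [q]
            · have : x = 0 := by simpa using q
              simp [this]
          rw [a0, d0]
          rw [z, a0] at h2'
          linear_combination (3 / 2) * h2'
        · linear_combination -e'
      · linear_combination -e
    obtain ⟨u, hu⟩ := IsAlgClosed.exists_eq_mul_self a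
    obtain ⟨v, hv⟩ := IsAlgClosed.exists_eq_mul_self d
    have hb2 : (b - u * v) * (b + u * v) = 0 := by
      rw [hu, hv] at key
      linear_combination key
    rcases mul_eq_zero.1 hb2 with q | q
    · refine ⟨![u, v], ?_⟩
      simp only [Fin.forall_fin_two, hκsym 1 0, ha, hb, hd]
      simp
      exact ⟨⟨hu, by linear_combination q⟩, by linear_combination q, hv⟩
    · refine ⟨![u, -v], ?_⟩
      simp only [Fin.forall_fin_two, hκsym 1 0, ha, hb, hd]
      simp
      exact ⟨⟨hu, by linear_combination q⟩, by linear_combination q, hv⟩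
  · rintro ⟨α, hα⟩
    refine ⟨ψ, α, fun A B C D => ?_⟩
    rw [F]
    simp only [hα]
    ring

end
end

section
/- Every symmetric valence-2 spinor κ over ℂ² factors into principal spinors: there exist α, β ∈ ℂ² such that κ_{AB} = α_{(A} β_{B)} (= (1/2)(α_A β_B + α_B β_A)) for all index values. -/
/-- Every symmetric valence-2 spinor over ℂ² factors into principal spinors:
κ_{AB} = α_{(A} β_{B)} = (1/2)(α_A β_B + α_B β_A). -/
theorem valence2_principal_factorization
    (κ : Fin 2 → Fin 2 → ℂ) (hκsym : ∀ A B, κ A B = κ B A) :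
    ∃ α β : Fin 2 → ℂ, ∀ A B, κ A B = (1 / 2 : ℂ) * (α A * β B + α B * β A) := by
  have h10 : κ 1 0 = κ 0 1 := hκsym 1 0
  by_cases ha : κ 0 0 = 0
  · refine ⟨![0, 1], ![2 * κ 0 1, κ 1 1], ?_⟩
    simp only [Fin.forall_fin_two, Matrix.cons_val_zero, Matrix.cons_val_one, h10, ha]
    refine ⟨⟨?_, ?_⟩, ?_, ?_⟩ <;> ring
  · obtain ⟨s, hs⟩ := IsAlgClosed.exists_pow_nat_eq (κ 0 1 ^ 2 - κ 0 0 * κ 1 1) (n := 2) (by norm_num)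
    refine ⟨![κ 0 0, κ 0 1 + s], ![1, (κ 0 1 - s) / κ 0 0], ?_⟩
    simp only [Fin.forall_fin_two, Matrix.cons_val_zero, Matrix.cons_val_one, h10]
    refine ⟨⟨?_, ?_⟩, ?_, ?_⟩
    · ring
    · field_simp
      ring
    · field_simp
      ring
    · field_simp
      linear_combination 2 * hs
end

section
/- Let T be a 2×2 complex matrix, regarded as the components τ^{AA'} (A the row index, A' the column index, primed index values identified with Fin 2), which is Hermitian, positive definite, and has det T = 1 (equivalently, τ_{AA'}τ^{AA'} = 2 and τ is the spinorial counterpart of a real future-pointing timelike vector). For a symmetric valence-2 spinor ν over ℂ² define its Hermitian conjugate ν̂_{AB} = Σ τ_A{}^{A'} τ_B{}^{B'} · conj(ν_{A'B'}), where τ_A{}^{A'} = Σ_B τ^{BA'} ε_{BA} and conj denotes entrywise complex conjugation of the components of ν. Then the contraction ν_{AB} ν̂^{AB} = Σ ν_{AB} ε^{AC} ε^{BD} ν̂_{CD} is a real number and is nonnegative. The same holds for a symmetric valence-4 spinor ξ: ξ_{ABCD} ξ̂^{ABCD} ≥ 0, with ξ̂_{ABCD} = Σ τ_A{}^{A'}τ_B{}^{B'}τ_C{}^{C'}τ_D{}^{D'}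 conj(ξ_{A'B'C'D'}) and all four indices raised with ε. -/
open scoped BigOperators ComplexOrder

noncomputable section

/-- τ_A{}^{A'} = Σ_B τ^{BA'} ε_{BA}, where T A A' = τ^{AA'}. -/
def tauMix (T : Matrix (Fin 2) (Fin 2) ℂ) (A A' : Fin 2) : ℂ :=
  ∑ B, T B A' * eps B A

/-- Hermitian conjugate of a valence-2 spinor:
ν̂_{AB} = Σ τ_A{}^{A'} τ_B{}^{B'} conj(ν_{A'B'}). -/
def hat2 (T : Matrix (Fin 2) (Fin 2) ℂ) (ν : Fin 2 → Fin 2 → ℂ) (A B : Fin 2) : ℂ :=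
  ∑ A', ∑ B', tauMix T A A' * tauMix T B B' * (starRingEnd ℂ) (ν A' B')

/-- Hermitian conjugate of a valence-4 spinor. -/
def hat4 (T : Matrix (Fin 2) (Fin 2) ℂ) (ξ : Fin 2 → Fin 2 → Fin 2 → Fin 2 → ℂ)
    (A B C D : Fin 2) : ℂ :=
  ∑ A', ∑ B', ∑ C', ∑ D',
    tauMix T A A' * tauMix T B B' * tauMix T C C' * tauMix T D D' *
      (starRingEnd ℂ) (ξ A' B' C' D')

theorem aux_tau0 (T : Matrix (Fin 2) (Fin 2) ℂ) (A : Fin 2) : tauMix T 0 A = - T 1 A := by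
  simp [tauMix, eps, Fin.sum_univ_two]

theorem aux_tau1 (T : Matrix (Fin 2) (Fin 2) ℂ) (A : Fin 2) : tauMix T 1 A = T 0 A := by
  simp [tauMix, eps, Fin.sum_univ_two]

theorem aux_two (T : Matrix (Fin 2) (Fin 2) ℂ) (ν : Fin 2 → Fin 2 → ℂ) (A B : Fin 2) :
    ∑ C, ∑ D, ν A B * eps A C * eps B D * hat2 T ν C D =
      ν A B * ∑ A', ∑ B', T A A' * T B B' * (starRingEnd ℂ) (ν A' B') := by
  fin_cases A <;> fin_cases B <;>
    simp [Fin.sum_univ_two, eps, hat2, aux_tau0, aux_tau1] <;> ring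

set_option maxHeartbeats 4000000 in
theorem aux_four (T : Matrix (Fin 2) (Fin 2) ℂ) (ξ : Fin 2 → Fin 2 → Fin 2 → Fin 2 → ℂ)
    (A B C D : Fin 2) :
    ∑ E, ∑ F, ∑ G, ∑ H,
        ξ A B C D * eps A E * eps B F * eps C G * eps D H * hat4 T ξ E F G H =
      ξ A B C D * ∑ A', ∑ B', ∑ C', ∑ D', T A A' * T B B' * T C C' * T D D' *
        (starRingEnd ℂ) (ξ A' B' C' D') := by
  fin_cases A <;> fin_cases B <;> fin_cases C <;> fin_cases D <;>
    simp [Fin.sum_univ_two, eps, hat4, aux_tau0, aux_tau1] <;> ring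

/-- For τ Hermitian, positive definite with det τ = 1, the contractions ν_{AB} ν̂^{AB} and
ξ_{ABCD} ξ̂^{ABCD} of symmetric spinors with their Hermitian conjugates are real and
nonnegative. -/
theorem hermitian_contraction_nonneg
    (T : Matrix (Fin 2) (Fin 2) ℂ)
    (hHerm : T.IsHermitian) (hPos : T.PosDef) (hdet : T.det = 1)
    (ν : Fin 2 → Fin 2 → ℂ) (hν : ∀ A B, ν A B = ν B A)
    (ξ : Fin 2 → Fin 2 → Fin 2 → Fin 2 → ℂ)
    (hξ : ∀ (v : Fin 4 → Fin 2) (σ : Equiv.Perm (Fin 4)),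
      ξ (v (σ 0)) (v (σ 1)) (v (σ 2)) (v (σ 3)) = ξ (v 0) (v 1) (v 2) (v 3)) :
    ((∑ A, ∑ B, ∑ C, ∑ D, ν A B * eps A C * eps B D * hat2 T ν C D).im = 0 ∧
      0 ≤ (∑ A, ∑ B, ∑ C, ∑ D, ν A B * eps A C * eps B D * hat2 T ν C D).re) ∧
    ((∑ A, ∑ B, ∑ C, ∑ D, ∑ E, ∑ F, ∑ G, ∑ H,
        ξ A B C D * eps A E * eps B F * eps C G * eps D H * hat4 T ξ E F G H).im = 0 ∧
      0 ≤ (∑ A, ∑ B, ∑ C, ∑ D, ∑ E, ∑ F, ∑ G, ∑ H,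
        ξ A B C D * eps A E * eps B F * eps C G * eps D H * hat4 T ξ E F G H).re) := by
  have h2 := (hPos.posSemidef.kronecker hPos.posSemidef)
  have h4 := h2.kronecker h2
  have k2 : 0 ≤ ∑ A, ∑ B, ∑ C, ∑ D, ν A B * eps A C * eps B D * hat2 T ν C D := by
    have := h2.dotProduct_mulVec_nonneg (fun p => (starRingEnd ℂ) (ν p.1 p.2))
    simp only [aux_two]
    simpa [dotProduct, Matrix.mulVec, Fintype.sum_prod_type, -Fin.sum_univ_two] using this
  have k4 : 0 ≤ ∑ A, ∑ B, ∑ C, ∑ D, ∑ E, ∑ F, ∑ G, ∑ H,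
        ξ A B C D * eps A E * eps B F * eps C G * eps D H * hat4 T ξ E F G H := by
    have := h4.dotProduct_mulVec_nonneg
      (fun p => (starRingEnd ℂ) (ξ p.1.1 p.1.2 p.2.1 p.2.2))
    simp only [aux_four]
    simpa [dotProduct, Matrix.mulVec, Fintype.sum_prod_type, -Fin.sum_univ_two, mul_assoc] using this
  rw [Complex.le_def] at k2 k4
  exact ⟨⟨k2.2.symm, k2.1⟩, ⟨k4.2.symm, k4.1⟩⟩

end
end

section
/- Let m ∈ ℝ and r₀ > max(m, 0). Let f : (r₀, ∞) → ℂ be continuous with f(r) = o(r^{−5}) as r → ∞ (i.e. r⁵ f(r) → 0 as r → ∞). Suppose y : (r₀, ∞) → ℂ is differentiable and satisfies the ordinary differential equation (1 − m/r) y'(r) + (3/r) y(r) = f(r) for all r ∈ (r₀, ∞). Then there exists a constant α ∈ ℂ such that y(r) = α r^{−3} + O(r^{−4}) as r → ∞; in particular r³ y(r) → α as r → ∞. -/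
open Filter Asymptotics

lemma aux_limit (w g : ℝ → ℂ) (R C : ℝ) (hR : 0 < R) (hC : 0 ≤ C)
    (hw : ∀ r, R ≤ r → HasDerivAt w (g r) r)
    (hg : ∀ r, R ≤ r → ‖g r‖ ≤ C / r ^ 2) :
    ∃ α : ℂ, ∀ r, R ≤ r → ‖w r - α‖ ≤ C / r := by
  have key : ∀ a b, R ≤ a → a ≤ b → ‖w b - w a‖ ≤ C / a := by
    intro a b ha hab
    have ha0 : 0 < a := by linarith
    have h := image_norm_le_of_norm_deriv_right_le_deriv_boundary' (a := a) (b := b)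
      (f := fun x => w x - w a) (f' := g) (B := fun x => C / a - C / x)
      (B' := fun x => C / x ^ 2) ?_ ?_ ?_ ?_ ?_ ?_ (Set.right_mem_Icc.2 hab)
    · have : 0 ≤ C / b := div_nonneg hC (by linarith)
      linarith
    · intro x hx
      exact ((hw x (ha.trans hx.1)).sub_const _).continuousAt.continuousWithinAt
    · intro x hx
      exact ((hw x (ha.trans hx.1)).sub_const _).hasDerivWithinAt
    · simp
    · intro x hx
      have : x ≠ 0 := by linarith [hx.1]
      exact (continuousAt_const.sub (continuousAt_const.div continuousAt_id this)).continuousWithinAt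
    · intro x hx
      have hx0 : x ≠ 0 := by linarith [hx.1]
      have := ((hasDerivAt_inv hx0).const_mul C).const_sub (C / a)
      refine HasDerivAt.hasDerivWithinAt (this.congr_deriv ?_)
      rw [div_eq_mul_inv]
      ring
    · intro x hx
      exact hg x (ha.trans hx.1)
  have hb : Tendsto (fun N : ℝ => 2 * (C / max N R)) atTop (nhds 0) := by
    have h1 : Tendsto (fun N : ℝ => max N R) atTop atTop :=
      tendsto_atTop_mono (fun N => le_max_left N R) tendsto_id
    simpa using (h1.const_div_atTop C).const_mul 2
  have hc : CauchySeq (fun r => w (max r R)) := by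
    refine cauchySeq_of_le_tendsto_0 (fun N : ℝ => 2 * (C / max N R)) ?_ hb
    intro n p N hn hp
    have h1 := key (max N R) (max n R) (le_max_right _ _) (max_le_max_right R hn)
    have h2 := key (max N R) (max p R) (le_max_right _ _) (max_le_max_right R hp)
    rw [← dist_eq_norm] at h1 h2
    have := dist_triangle_right (w (max n R)) (w (max p R)) (w (max N R))
    linarith
  obtain ⟨α, hα⟩ := cauchySeq_tendsto_of_complete hc
  refine ⟨α, fun r hr => ?_⟩
  have h3 : Tendsto (fun s => ‖w r - w (max s R)‖) atTop (nhds ‖w r - α‖) :=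
    (tendsto_const_nhds.sub hα).norm
  refine le_of_tendsto h3 ?_
  filter_upwards [eventually_ge_atTop r] with s hs
  rw [norm_sub_rev]
  exact key r _ hr (hs.trans (le_max_left _ _))

/-- If y solves (1 − m/r) y' + (3/r) y = f on (r₀, ∞) with r₀ > max(m, 0) and
f continuous with f(r) = o(r⁻⁵), then y(r) = α r⁻³ + O(r⁻⁴) for some constant α;
in particular r³ y(r) → α. -/
theorem ode_monopole_asymptotics
    (m r₀ : ℝ) (hr₀ : max m 0 < r₀)
    (f : ℝ → ℂ) (hf : ContinuousOn f (Set.Ioi r₀))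
    (hfo : Tendsto (fun r : ℝ => (r : ℂ) ^ 5 * f r) atTop (nhds 0))
    (y y' : ℝ → ℂ)
    (hy : ∀ r ∈ Set.Ioi r₀, HasDerivAt y (y' r) r)
    (hode : ∀ r ∈ Set.Ioi r₀,
      (1 - (m : ℂ) / (r : ℂ)) * y' r + (3 / (r : ℂ)) * y r = f r) :
    ∃ α : ℂ,
      ((fun r : ℝ => y r - α / (r : ℂ) ^ 3) =O[atTop] fun r : ℝ => (r ^ 4)⁻¹) ∧
      Tendsto (fun r : ℝ => (r : ℂ) ^ 3 * y r) atTop (nhds α) := by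
  have hm : m < r₀ := (le_max_left _ _).trans_lt hr₀
  have h0 : 0 < r₀ := (le_max_right _ _).trans_lt hr₀
  have hev : ∀ᶠ r : ℝ in atTop, ‖(r : ℂ) ^ 5 * f r‖ ≤ 1 := by
    have := hfo.norm
    rw [norm_zero] at this
    exact this.eventually_le_const one_pos
  obtain ⟨R₁, hR₁⟩ := eventually_atTop.1 hev
  obtain ⟨R, hRa, hRb, hRc⟩ : ∃ R, R₁ ≤ R ∧ r₀ < R ∧ 2 * |m| ≤ R :=
    ⟨max R₁ (max (r₀ + 1) (2 * |m|)), by simp, by simp, by simp⟩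
  have hR0 : 0 < R := h0.trans hRb
  obtain ⟨α, hα⟩ := aux_limit (fun r => ((r : ℂ) - m) ^ 3 * y r)
    (fun r => ((r : ℂ) - m) ^ 2 * r * f r) R 4 hR0 (by norm_num) (by
      intro r hr
      have hr' : r₀ < r := by linarith
      have hrc : (r : ℂ) ≠ 0 := by exact_mod_cast (by linarith : r ≠ 0)
      have h1 : HasDerivAt (fun r : ℝ => (r : ℂ) - m) 1 r :=
        (HasDerivAt.ofReal_comp (hasDerivAt_id r)).sub_const _ |>.congr_deriv (by simp)
      refine ((h1.pow 3).mul (hy r hr')).congr_deriv ?_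
      rw [← hode r hr']
      simp
      field_simp
      ring) (by
      intro r hr
      have hr0 : 0 < r := by linarith
      have h1 := hR₁ r (hRa.trans hr)
      have h2 : ‖(r : ℂ) - m‖ ≤ 2 * r := by
        rw [← Complex.ofReal_sub, Complex.norm_real, Real.norm_eq_abs, abs_le]
        constructor <;> linarith [neg_abs_le m, le_abs_self m, abs_nonneg m]
      rw [norm_mul, norm_pow, Complex.norm_real, Real.norm_of_nonneg hr0.le] at h1
      rw [norm_mul, norm_mul, norm_pow, Complex.norm_real, Real.norm_of_nonneg hr0.le,
        le_div_iff₀ (by positivity)]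
      calc ‖(r : ℂ) - m‖ ^ 2 * r * ‖f r‖ * r ^ 2 ≤ (2 * r) ^ 2 * r * ‖f r‖ * r ^ 2 := by gcongr
        _ = 4 * (r ^ 5 * ‖f r‖) := by ring
        _ ≤ 4 := by linarith)
  have hO : (fun r : ℝ => y r - α / (r : ℂ) ^ 3) =O[atTop] fun r : ℝ => (r ^ 4)⁻¹ := by
    refine IsBigO.of_bound (32 + ‖α‖ * (56 * |m|)) ?_
    filter_upwards [eventually_ge_atTop R] with r hr
    have hr0 : 0 < r := by linarith
    have hma := abs_nonneg m
    have hlow : r / 2 ≤ r - m := by linarith [le_abs_self m]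
    have hpos : 0 < r - m := by linarith
    have hrc : (r : ℂ) ≠ 0 := by exact_mod_cast hr0.ne'
    have hrm : (r : ℂ) - m ≠ 0 := by exact_mod_cast hpos.ne'
    have hn : ‖(r : ℂ) - m‖ = r - m := by
      rw [← Complex.ofReal_sub, Complex.norm_real, Real.norm_of_nonneg hpos.le]
    have e : y r - α / (r : ℂ) ^ 3 = (((r : ℂ) - m) ^ 3 * y r - α) / ((r : ℂ) - m) ^ 3
        + α * (((m * (3 * r ^ 2 - 3 * r * m + m ^ 2) / ((r - m) ^ 3 * r ^ 3) : ℝ)) : ℂ) := by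
      push_cast
      field_simp
      ring
    have hinv : 1 / (r - m) ^ 3 ≤ 8 / r ^ 3 := by
      calc 1 / (r - m) ^ 3 ≤ 1 / (r / 2) ^ 3 := by gcongr
        _ = 8 / r ^ 3 := by field_simp; norm_num
    have hA : ‖(((r : ℂ) - m) ^ 3 * y r - α) / ((r : ℂ) - m) ^ 3‖ ≤ 32 * (r ^ 4)⁻¹ := by
      rw [norm_div, norm_pow, hn, div_eq_mul_one_div]
      calc _ ≤ 4 / r * (8 / r ^ 3) := by
            gcongr
            exact hα r hr
        _ = 32 * (r ^ 4)⁻¹ := by field_simp; norm_num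
    have hq : |3 * r ^ 2 - 3 * r * m + m ^ 2| ≤ 7 * r ^ 2 := by
      have h1 : m ≤ r := by linarith
      have h2 : -r ≤ m := by linarith [neg_abs_le m]
      rw [abs_le]
      constructor <;> nlinarith
    have hB : ‖(((m * (3 * r ^ 2 - 3 * r * m + m ^ 2) / ((r - m) ^ 3 * r ^ 3) : ℝ)) : ℂ)‖
        ≤ 56 * |m| * (r ^ 4)⁻¹ := by
      rw [Complex.norm_real, Real.norm_eq_abs, abs_div, abs_mul,
        abs_of_pos (by positivity : 0 < (r - m) ^ 3 * r ^ 3)]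
      calc _ = |m| * |3 * r ^ 2 - 3 * r * m + m ^ 2| * (1 / (r - m) ^ 3) * (1 / r ^ 3) := by
            field_simp
        _ ≤ |m| * (7 * r ^ 2) * (8 / r ^ 3) * (1 / r ^ 3) := by gcongr
        _ = 56 * |m| * (r ^ 4)⁻¹ := by field_simp; ring
    rw [e, Real.norm_of_nonneg (by positivity : 0 ≤ (r ^ 4)⁻¹)]
    refine (norm_add_le _ _).trans ?_
    rw [norm_mul]
    have := mul_le_mul_of_nonneg_left hB (norm_nonneg α)
    linarith
  refine ⟨α, hO, ?_⟩
  have h1 : (fun r : ℝ => (r : ℂ) ^ 3) =O[atTop] fun r : ℝ => r ^ 3 :=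
    IsBigO.of_bound 1 (Eventually.of_forall fun r => by simp)
  have h2 := h1.mul hO
  have h3 : Tendsto (fun r : ℝ => r ^ 3 * (r ^ 4)⁻¹) atTop (nhds 0) := by
    refine tendsto_inv_atTop_zero.congr' ?_
    filter_upwards [eventually_gt_atTop 0] with r hr
    field_simp
  have h4 := (h2.trans_tendsto h3).add_const α
  rw [zero_add] at h4
  refine h4.congr' ?_
  filter_upwards [eventually_gt_atTop 0] with r hr
  have hrc : (r : ℂ) ≠ 0 := by exact_mod_cast hr.ne'
  field_simp
  ring
end
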